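/- arXiv:2603.17634 — 3 statements merged into one kernel-verified Lean document; each statement's English description precedes it below -/
import Mathlib

section
/- Let S and A be types, f : S → A → S a transition function, Safe : S → A → Prop a constraint predicate, H ≥ 1 a horizon, and π̄ : S → A a baseline policy such that Safe(s, π̄(s)) holds for every s ∈ S. Suppose the action sequence a = (a₀, …, a_{H−1}) is feasible from the state s, with predicted trajectory s₀ = s, s_{t+1} = f(s_t, a_t). Then the shifted candidate sequence (a₁, …, a_{H−1}, π̄(s_H)), obtained by dropping the first action and appending the baseline action at the terminal predicted state s_H, is feasible from the successor state s₁ = f(s, a₀). -/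
/-- Predicted trajectory: `traj f s a t` is the state after applying actions
`a 0, …, a (t-1)` starting from `s`. -/
def traj {S A : Type*} (f : S → A → S) (s : S) (a : ℕ → A) : ℕ → S
  | 0 => s
  | t + 1 => f (traj f s a t) (a t)

/-- An action sequence `a` is feasible from `s` over horizon `H` if every
state–action pair along the predicted trajectory satisfies the constraints. -/
def Feasible {S A : Type*} (f : S → A → S) (Safe : S → A → Prop) (H : ℕ)
    (s : S) (a : ℕ → A) : Prop :=
  ∀ t < H, Safe (traj f s a t) (a t)

theorem traj_succ_eq_of_forall_lt {S A : Type*} (f : S → A → S) (s : S) (a b : ℕ → A) (n : ℕ)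
    (hab : ∀ t < n, b t = a (t + 1)) : traj f (f s (a 0)) b n = traj f s a (n + 1) := by
  induction n with
  | zero => rfl
  | succ n ih =>
    rw [traj, ih fun t ht => hab t (Nat.lt_succ_of_lt ht), hab n n.lt_succ_self]
    rfl

/-- Shift-and-append construction: if `a` is feasible from `s`, then dropping the
first action and appending the baseline action at the terminal predicted state
yields a sequence feasible from the successor state `f s (a 0)`. -/
theorem shifted_sequence_feasible {S A : Type*} (f : S → A → S) (Safe : S → A → Prop)
    (H : ℕ) (hH : 1 ≤ H) (πb : S → A) (hπb : ∀ s, Safe s (πb s))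
    (s : S) (a : ℕ → A) (ha : Feasible f Safe H s a) :
    Feasible f Safe H (f s (a 0))
      (fun t => if t < H - 1 then a (t + 1) else πb (traj f s a H)) := by
  intro t ht
  rw [traj_succ_eq_of_forall_lt f s a _ t fun i hi => if_pos (by omega)]
  dsimp only
  split_ifs with h
  · exact ha (t + 1) (by omega)
  · exact (show t + 1 = H by omega) ▸ hπb _
end

section
/- Let S and A be types, f : S → A → S a transition function, Safe : S → A → Prop a constraint predicate, H ≥ 1 a horizon, and π̄ : S → A a baseline policy with Safe(s, π̄(s)) for every s ∈ S. Let J : S × A → ℝ be a stage cost with J ≥ 0 and J_H : S → ℝ a terminal cost with J_H ≥ 0, satisfying the terminal decrease condition: for every s ∈ S, J(s, π̄(s)) + J_H(f(s, π̄(s))) ≤ J_H(s). For s with Feas(s) nonempty define the optimal value V(s) = inf{Cost(s, a) : a ∈ Feas(s)}. Then: (i) for every a ∈ Feas(s), the set Feas(f(s, a₀)) is nonempty and V(f(s, a₀)) ≤ Cost(s, a) − J(s, a₀); and consequently (ii) if a* ∈ Feas(s) attains V(s), then V(f(s, a*₀)) ≤ V(s) − J(s, a*₀); in particular the optimal value function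 is nonincreasing along the receding-horizon closed loop. -/
/-- The set of feasible `H`-step action sequences from `s`. -/
def Feas {S A : Type*} (f : S → A → S) (Safe : S → A → Prop) (H : ℕ)
    (s : S) : Set (ℕ → A) :=
  {a | Feasible f Safe H s a}

/-- Total cost of applying the action sequence `a` from state `s` over horizon
`H`: accumulated stage cost plus terminal cost at the predicted terminal state. -/
noncomputable def Cost {S A : Type*} (f : S → A → S) (H : ℕ)
    (J : S → A → ℝ) (JH : S → ℝ) (s : S) (a : ℕ → A) : ℝ :=
  (∑ t ∈ Finset.range H, J (traj f s a t) (a t)) + JH (traj f s a H)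

/-- Optimal MPC value: infimum of the total cost over the feasible set. -/
noncomputable def Vval {S A : Type*} (f : S → A → S) (Safe : S → A → Prop)
    (H : ℕ) (J : S → A → ℝ) (JH : S → ℝ) (s : S) : ℝ :=
  sInf (Cost f H J JH s '' Feas f Safe H s)

/-- Drop the first of `n + 1` actions and append the action `c`. -/
def shiftAppend {A : Type*} (n : ℕ) (a : ℕ → A) (c : A) : ℕ → A :=
  fun t => if t < n then a (t + 1) else c

lemma shiftAppend_of_lt {A : Type*} {n t : ℕ} (a : ℕ → A) (c : A) (h : t < n) :
    shiftAppend n a c t = a (t + 1) :=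
  if_pos h

lemma shiftAppend_self {A : Type*} (n : ℕ) (a : ℕ → A) (c : A) :
    shiftAppend n a c n = c :=
  if_neg (lt_irrefl n)

lemma traj_shiftAppend {S A : Type*} (f : S → A → S) (s : S) {n : ℕ} (a : ℕ → A) (c : A)
    {t : ℕ} (ht : t ≤ n) :
    traj f (f s (a 0)) (shiftAppend n a c) t = traj f s a (t + 1) := by
  induction t with
  | zero => rfl
  | succ t ih =>
    rw [traj, ih (by omega), shiftAppend_of_lt a c ht]
    rfl

lemma shiftAppend_mem_feas {S A : Type*} {f : S → A → S} {Safe : S → A → Prop} {n : ℕ}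
    {s : S} {a : ℕ → A} {c : A} (ha : a ∈ Feas f Safe (n + 1) s)
    (hc : Safe (traj f s a (n + 1)) c) :
    shiftAppend n a c ∈ Feas f Safe (n + 1) (f s (a 0)) := by
  intro t ht
  rw [traj_shiftAppend f s a c (Nat.le_of_lt_succ ht)]
  rcases Nat.lt_succ_iff_lt_or_eq.mp ht with h | rfl
  · rw [shiftAppend_of_lt a c h]
    exact ha (t + 1) (by omega)
  · rwa [shiftAppend_self]

lemma cost_shiftAppend {S A : Type*} (f : S → A → S) (n : ℕ) (J : S → A → ℝ) (JH : S → ℝ)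
    (s : S) (a : ℕ → A) (c : A) :
    Cost f (n + 1) J JH (f s (a 0)) (shiftAppend n a c) =
      Cost f (n + 1) J JH s a - J s (a 0) - JH (traj f s a (n + 1)) +
        (J (traj f s a (n + 1)) c + JH (f (traj f s a (n + 1)) c)) := by
  have hsum : ∑ t ∈ Finset.range n, J (traj f (f s (a 0)) (shiftAppend n a c) t)
        (shiftAppend n a c t) =
      ∑ t ∈ Finset.range n, J (traj f s a (t + 1)) (a (t + 1)) := by
    refine Finset.sum_congr rfl fun t ht => ?_
    have h := Finset.mem_range.mp ht
    rw [traj_shiftAppend f s a c h.le, shiftAppend_of_lt a c h]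
  have hlast : traj f (f s (a 0)) (shiftAppend n a c) (n + 1) =
      f (traj f s a (n + 1)) c := by
    rw [traj, traj_shiftAppend f s a c le_rfl, shiftAppend_self]
  have hzero : traj f s a 0 = s := rfl
  unfold Cost
  rw [Finset.sum_range_succ, hsum, hlast, traj_shiftAppend f s a c le_rfl, shiftAppend_self,
    Finset.sum_range_succ', hzero]
  ring

lemma cost_nonneg {S A : Type*} (f : S → A → S) (H : ℕ) {J : S → A → ℝ} {JH : S → ℝ}
    (hJ : ∀ s a, 0 ≤ J s a) (hJH : ∀ s, 0 ≤ JH s) (s : S) (a : ℕ → A) :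
    0 ≤ Cost f H J JH s a :=
  add_nonneg (Finset.sum_nonneg fun _ _ => hJ _ _) (hJH _)

lemma vval_le_cost {S A : Type*} {f : S → A → S} {Safe : S → A → Prop} {H : ℕ}
    {J : S → A → ℝ} {JH : S → ℝ} (hJ : ∀ s a, 0 ≤ J s a) (hJH : ∀ s, 0 ≤ JH s)
    {s : S} {a : ℕ → A} (ha : a ∈ Feas f Safe H s) :
    Vval f Safe H J JH s ≤ Cost f H J JH s a := by
  refine csInf_le ⟨0, ?_⟩ (Set.mem_image_of_mem _ ha)
  rintro _ ⟨b, -, rfl⟩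
  exact cost_nonneg f H hJ hJH s b

/-- Value decrease along the receding-horizon closed loop: under a safe baseline
policy and the terminal decrease condition,
(i) for every feasible sequence `a` from `s`, the successor state `f s (a 0)` is
feasible and `V(f s (a 0)) ≤ Cost(s, a) − J(s, a 0)`; and consequently
(ii) if `a*` attains the optimal value at `s`, then
`V(f s (a* 0)) ≤ V(s) − J(s, a* 0)`. -/
theorem value_decrease {S A : Type*} (f : S → A → S) (Safe : S → A → Prop)
    (H : ℕ) (hH : 1 ≤ H) (πb : S → A) (hπb : ∀ s, Safe s (πb s))
    (J : S → A → ℝ) (hJ : ∀ s a, 0 ≤ J s a)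
    (JH : S → ℝ) (hJH : ∀ s, 0 ≤ JH s)
    (hterm : ∀ s, J s (πb s) + JH (f s (πb s)) ≤ JH s) :
    (∀ s : S, ∀ a ∈ Feas f Safe H s,
        (Feas f Safe H (f s (a 0))).Nonempty ∧
        Vval f Safe H J JH (f s (a 0)) ≤ Cost f H J JH s a - J s (a 0)) ∧
    (∀ s : S, ∀ a ∈ Feas f Safe H s,
        Cost f H J JH s a = Vval f Safe H J JH s →
        Vval f Safe H J JH (f s (a 0)) ≤ Vval f Safe H J JH s - J s (a 0)) := by
  have key : ∀ s : S, ∀ a ∈ Feas f Safe H s,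
      (Feas f Safe H (f s (a 0))).Nonempty ∧
      Vval f Safe H J JH (f s (a 0)) ≤ Cost f H J JH s a - J s (a 0) := by
    obtain ⟨n, rfl⟩ := Nat.exists_eq_add_of_le' hH
    intro s a ha
    have hb := shiftAppend_mem_feas ha (hπb (traj f s a (n + 1)))
    refine ⟨⟨_, hb⟩, (vval_le_cost hJ hJH hb).trans ?_⟩
    rw [cost_shiftAppend]
    linarith [hterm (traj f s a (n + 1))]
  exact ⟨key, fun s a ha hopt => hopt ▸ (key s a ha).2⟩
end

section
/- Let S be a finite type and A a finite nonempty type, f : S → A → S a transition function, Safe : S → A → Prop a constraint predicate, H ≥ 1 a horizon, and π̄ : S → A a baseline policy with Safe(s, π̄(s)) for every s ∈ S. Let g ∈ S be a goal state, J : S × A → ℝ a stage cost with J(s, a) ≥ 0 and J(s, a) = 0 if and only if s = g, and J_H : S → ℝ a terminal cost with J_H ≥ 0, satisfying the terminal decrease condition: for every s ∈ S, J(s, π̄(s)) + J_H(f(s, π̄(s))) ≤ J_H(s). Consider the receding-horizon closed loop: σ₀ is a state with Feas(σ₀) nonempty, and for each k the controller chooses a^k ∈ Feas(σ_k) minimizing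 Cost(σ_k, ·) over Feas(σ_k) and sets σ_{k+1} = f(σ_k, a^k₀). Then the closed loop is well defined for all k (Feas(σ_k) is always nonempty), the optimal values V(σ_k) are nonincreasing in k, and there exists K such that σ_k = g for all k ≥ K; i.e., the receding-horizon policy drives the system to the goal mode and is asymptotically stable with respect to it. -/
/-- The predicted trajectory under the shifted plan, continued by an arbitrary last action, agrees
with the shifted trajectory. -/
theorem traj_shift {S A : Type*} (f : S → A → S) (s : S) (a : ℕ → A) (n : ℕ) (x : A) :
    ∀ t ≤ n, traj f (f s (a 0)) (fun t => if t < n then a (t + 1) else x) t =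
      traj f s a (t + 1) := by
  intro t
  induction t with
  | zero => intro _; rfl
  | succ t ih =>
    intro ht
    rw [traj, ih (by omega)]
    simp only [if_pos (show t < n by omega)]
    rfl

/-- From a feasible plan, shifting by one step and appending the baseline action gives a feasible
plan at the successor state, whose cost drops by at least the first stage cost. -/
theorem exists_feasible_shift {S A : Type*} (f : S → A → S) (Safe : S → A → Prop) {H : ℕ}
    (hH : 1 ≤ H) (πb : S → A) (hπb : ∀ s, Safe s (πb s)) (J : S → A → ℝ) (JH : S → ℝ)
    (hterm : ∀ s, J s (πb s) + JH (f s (πb s)) ≤ JH s)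
    (s : S) (a : ℕ → A) (ha : a ∈ Feas f Safe H s) :
    ∃ b ∈ Feas f Safe H (f s (a 0)),
      J s (a 0) + Cost f H J JH (f s (a 0)) b ≤ Cost f H J JH s a := by
  obtain ⟨n, rfl⟩ : ∃ n, H = n + 1 := ⟨H - 1, by omega⟩
  have key := traj_shift f s a n (πb (traj f s a (n + 1)))
  set b : ℕ → A := fun t => if t < n then a (t + 1) else πb (traj f s a (n + 1)) with hb
  have hlt : ∀ t < n, b t = a (t + 1) := fun t ht => by simp [hb, ht]
  have hn : b n = πb (traj f s a (n + 1)) := by simp [hb]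
  refine ⟨b, fun t ht => ?_, ?_⟩
  · rw [key t (by omega)]
    rcases Nat.lt_succ_iff_lt_or_eq.mp ht with h | rfl
    · rw [hlt t h]
      exact ha (t + 1) (by omega)
    · rw [hn]
      exact hπb _
  · have hsum : ∑ t ∈ Finset.range n, J (traj f (f s (a 0)) b t) (b t) =
        ∑ t ∈ Finset.range n, J (traj f s a (t + 1)) (a (t + 1)) := by
      refine Finset.sum_congr rfl fun t ht => ?_
      have ht := Finset.mem_range.mp ht
      rw [key t ht.le, hlt t ht]
    have hlast : traj f (f s (a 0)) b (n + 1) =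
        f (traj f s a (n + 1)) (πb (traj f s a (n + 1))) := by
      rw [traj, key n le_rfl, hn]
    have hzero : traj f s a 0 = s := rfl
    unfold Cost
    rw [Finset.sum_range_succ, hsum, hlast, key n le_rfl, hn, Finset.sum_range_succ', hzero]
    linarith [hterm (traj f s a (n + 1))]

/-- The optimal value is the cost of any minimizing feasible plan. -/
theorem Vval_eq_cost {S A : Type*} (f : S → A → S) (Safe : S → A → Prop) (H : ℕ)
    (J : S → A → ℝ) (JH : S → ℝ) (s : S) (a : ℕ → A) (ha : a ∈ Feas f Safe H s)
    (hmin : ∀ b ∈ Feas f Safe H s, Cost f H J JH s a ≤ Cost f H J JH s b) :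
    Vval f Safe H J JH s = Cost f H J JH s a := by
  refine IsLeast.csInf_eq ⟨Set.mem_image_of_mem _ ha, ?_⟩
  rintro _ ⟨b, hb, rfl⟩
  exact hmin b hb

/-- Asymptotic stability of the receding-horizon policy with respect to the goal
mode: under a safe baseline policy, the terminal decrease condition, and a stage
cost vanishing exactly at the goal mode, the closed loop that at each step
applies the first action of a cost-minimizing feasible plan remains recursively
feasible, has nonincreasing optimal values, and eventually stays in the goal
mode. -/
theorem receding_horizon_asymptotic_stability {S A : Type*}
    [Finite S] [Finite A] [Nonempty A]
    (f : S → A → S) (Safe : S → A → Prop) (H : ℕ) (hH : 1 ≤ H)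
    (πb : S → A) (hπb : ∀ s, Safe s (πb s))
    (g : S) (J : S → A → ℝ) (hJnonneg : ∀ s a, 0 ≤ J s a)
    (hJzero : ∀ s a, J s a = 0 ↔ s = g)
    (JH : S → ℝ) (hJH : ∀ s, 0 ≤ JH s)
    (hterm : ∀ s, J s (πb s) + JH (f s (πb s)) ≤ JH s)
    (σ : ℕ → S) (plan : ℕ → ℕ → A)
    (h0 : (Feas f Safe H (σ 0)).Nonempty)
    (hplan : ∀ k, (Feas f Safe H (σ k)).Nonempty →
        plan k ∈ Feas f Safe H (σ k) ∧
        ∀ b ∈ Feas f Safe H (σ k),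
          Cost f H J JH (σ k) (plan k) ≤ Cost f H J JH (σ k) b)
    (hstep : ∀ k, σ (k + 1) = f (σ k) (plan k 0)) :
    (∀ k, (Feas f Safe H (σ k)).Nonempty) ∧
    (∀ k, Vval f Safe H J JH (σ (k + 1)) ≤ Vval f Safe H J JH (σ k)) ∧
    (∃ K : ℕ, ∀ k ≥ K, σ k = g) := by
  have hfeas : ∀ k, (Feas f Safe H (σ k)).Nonempty := by
    intro k
    induction k with
    | zero => exact h0
    | succ k ih =>
      obtain ⟨b, hb, -⟩ := exists_feasible_shift f Safe hH πb hπb J JH hterm (σ k) (plan k)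
        (hplan k ih).1
      rw [hstep]
      exact ⟨b, hb⟩
  have hV : ∀ k, Vval f Safe H J JH (σ k) = Cost f H J JH (σ k) (plan k) := fun k =>
    Vval_eq_cost f Safe H J JH _ _ (hplan k (hfeas k)).1 (hplan k (hfeas k)).2
  have hdec : ∀ k, J (σ k) (plan k 0) + Vval f Safe H J JH (σ (k + 1)) ≤
      Vval f Safe H J JH (σ k) := by
    intro k
    obtain ⟨b, hb, hcost⟩ := exists_feasible_shift f Safe hH πb hπb J JH hterm (σ k) (plan k)
      (hplan k (hfeas k)).1
    rw [← hstep] at hb hcost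
    rw [hV, hV]
    linarith [(hplan (k + 1) (hfeas (k + 1))).2 b hb]
  have hVnonneg : ∀ k, 0 ≤ Vval f Safe H J JH (σ k) := fun k => by
    rw [hV]
    exact add_nonneg (Finset.sum_nonneg fun _ _ => hJnonneg _ _) (hJH _)
  refine ⟨hfeas, fun k => by linarith [hdec k, hJnonneg (σ k) (plan k 0)], ?_⟩
  have hpartial : ∀ n, ∑ k ∈ Finset.range n, J (σ k) (plan k 0) ≤
      Vval f Safe H J JH (σ 0) - Vval f Safe H J JH (σ n) := by
    intro n
    induction n with
    | zero => simp
    | succ n ih =>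
      rw [Finset.sum_range_succ]
      linarith [hdec n]
  have hsummable : Summable fun k => J (σ k) (plan k 0) :=
    summable_of_sum_range_le (fun _ => hJnonneg _ _)
      fun n => (hpartial n).trans (sub_le_self _ (hVnonneg n))
  obtain ⟨c, hc, hcJ⟩ : ∃ c > 0, ∀ s a, s ≠ g → c ≤ J s a := by
    by_cases hne : {p : S × A | p.1 ≠ g}.Nonempty
    · obtain ⟨p, hp, hmin⟩ := Set.exists_min_image _ (fun p : S × A => J p.1 p.2)
        (Set.toFinite {p : S × A | p.1 ≠ g}) hne
      exact ⟨J p.1 p.2, (hJnonneg _ _).lt_of_ne' fun h => hp ((hJzero _ _).mp h),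
        fun s a hs => hmin (s, a) hs⟩
    · exact ⟨1, one_pos, fun s a hs => (hne ⟨(s, a), hs⟩).elim⟩
  obtain ⟨K, hK⟩ := Filter.eventually_atTop.mp
    (hsummable.tendsto_atTop_zero.eventually_lt_const hc)
  refine ⟨K, fun k hk => ?_⟩
  by_contra hne
  exact (hK k hk).not_ge (hcJ _ _ hne)
end
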